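/- For γ ∈ (0,1), δ ∈ (0,1), γ' > γ and δ' ≥ 0 with γ' + δ' < γ + δ, every continuous function w : ℝ₋ → ℝ with w(0) = 0 and ‖w‖_{γ',δ'} < ∞ belongs to the space W_{(γ,δ)} (i.e. is a limit in the ‖·‖_{γ,δ} norm of smooth compactly supported functions). -/

import Mathlib

open Set

open Filter Topology MeasureTheory in
lemma aux_interp (γ δ p q K ε : ℝ) (hγ : 0 < γ) (hp : γ < p) (hq : q ≤ δ)
    (hpq : p + q < γ + δ) (hδ : 0 < δ) (hK : 0 ≤ K) (hε : 0 < ε) :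
    ∃ A0 : ℝ, 0 < A0 ∧ ∃ κ > 0, ∀ f : ℝ → ℝ,
      (∀ s t : ℝ, s ≤ 0 → t ≤ 0 → |f t - f s| ≤ K * |t - s| ^ p * (1 + |t| + |s|) ^ q) →
      (∀ t, |t| ≤ A0 → t ≤ 0 → |f t| ≤ κ) →
      ∀ s t : ℝ, s ≤ 0 → t ≤ 0 → s ≠ t →
        |f t - f s| ≤ ε * |t - s| ^ γ * (1 + |t| + |s|) ^ δ := by
  have e1 : ∃ A0 : ℝ, 0 < A0 ∧ ∀ A ≥ A0, K * A ^ (-(γ + δ - p - q)) ≤ ε := by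
    have h : Tendsto (fun A : ℝ => K * A ^ (-(γ + δ - p - q))) atTop (𝓝 (K * 0)) :=
      (tendsto_rpow_neg_atTop (by linarith)).const_mul K
    rw [mul_zero] at h
    have h2 := (h.eventually (ge_mem_nhds hε))
    obtain ⟨a, ha⟩ := eventually_atTop.1 h2
    exact ⟨max a 1, by positivity, fun A hA => ha A (le_trans (le_max_left _ _) hA)⟩
  have e2 : ∃ η : ℝ, 0 < η ∧ K * η ^ (p - γ) ≤ ε := by
    have h : Tendsto (fun x : ℝ => K * x ^ (p - γ)) (𝓝[>] 0) (𝓝 (K * 0 ^ (p - γ))) :=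
      ((Real.continuousAt_rpow_const 0 (p - γ) (Or.inr (by linarith))).tendsto.mono_left
        nhdsWithin_le_nhds).const_mul K
    rw [Real.zero_rpow (by linarith), mul_zero] at h
    have h2 := (h.eventually (ge_mem_nhds hε)).and self_mem_nhdsWithin
    obtain ⟨a, ha, ha'⟩ := h2.exists
    exact ⟨a, ha', ha⟩
  obtain ⟨A0, hA0, hA⟩ := e1
  obtain ⟨η, hη, hηK⟩ := e2
  refine ⟨A0, hA0, ε * η ^ γ / 2, by positivity, ?_⟩
  intro f hf hfs s t hs ht hst
  have hd : 0 < |t - s| := abs_pos.2 (sub_ne_zero.2 (Ne.symm hst))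
  have hdA : |t - s| ≤ 1 + |t| + |s| := by
    have := abs_sub t s; linarith
  have hA1 : 1 ≤ 1 + |t| + |s| := by linarith [abs_nonneg t, abs_nonneg s]
  have hb := hf s t hs ht
  have ht1 : |t| ≤ 1 + |t| + |s| := by linarith [abs_nonneg s]
  have hs1 : |s| ≤ 1 + |t| + |s| := by linarith [abs_nonneg t]
  generalize 1 + |t| + |s| = A at *
  generalize |t - s| = d at *
  have hA' : 0 < A := by linarith
  rcases le_total A0 A with h | h
  · refine hb.trans ?_
    have k1 : d ^ p = d ^ (p - γ) * d ^ γ := by rw [← Real.rpow_add hd]; ring_nf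
    have k2 : d ^ (p - γ) ≤ A ^ (p - γ) := Real.rpow_le_rpow hd.le hdA (by linarith)
    have k3 : A ^ (p - γ) * A ^ q = A ^ (-(γ + δ - p - q)) * A ^ δ := by
      rw [← Real.rpow_add hA', ← Real.rpow_add hA']; ring_nf
    calc K * d ^ p * A ^ q = K * d ^ γ * (d ^ (p - γ) * A ^ q) := by rw [k1]; ring
      _ ≤ K * d ^ γ * (A ^ (p - γ) * A ^ q) := by gcongr
      _ = (K * A ^ (-(γ + δ - p - q))) * d ^ γ * A ^ δ := by rw [k3]; ring
      _ ≤ ε * d ^ γ * A ^ δ := by gcongr; exact hA A h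
  rcases le_total d η with h' | h'
  · refine hb.trans ?_
    have k1 : d ^ p = d ^ (p - γ) * d ^ γ := by rw [← Real.rpow_add hd]; ring_nf
    have k2 : d ^ (p - γ) ≤ η ^ (p - γ) := Real.rpow_le_rpow hd.le h' (by linarith)
    have k3 : A ^ q ≤ A ^ δ := Real.rpow_le_rpow_of_exponent_le hA1 hq
    calc K * d ^ p * A ^ q = (K * d ^ (p - γ)) * d ^ γ * A ^ q := by rw [k1]; ring
      _ ≤ (K * η ^ (p - γ)) * d ^ γ * A ^ δ := by gcongr
      _ ≤ ε * d ^ γ * A ^ δ := by gcongr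
  · have a1 := hfs t (by linarith) ht
    have a2 := hfs s (by linarith) hs
    have a3 := abs_sub (f t) (f s)
    have k1 : η ^ γ ≤ d ^ γ := Real.rpow_le_rpow hη.le h' hγ.le
    have k2 : 1 ≤ A ^ δ := Real.one_le_rpow hA1 hδ.le
    calc |f t - f s| ≤ ε * η ^ γ * 1 := by linarith
      _ ≤ ε * d ^ γ * A ^ δ := by gcongr

open Filter Topology MeasureTheory in
lemma aux_mollify (p q C : ℝ) (hp : 0 < p) (hq : 0 ≤ q) (hC : 0 ≤ C) (v : ℝ → ℝ)
    (hv : Continuous v) (hv0 : v 0 = 0)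
    (hb : ∀ s t : ℝ, |v t - v s| ≤ C * |t - s| ^ p * (1 + |t| + |s|) ^ q)
    (A0 : ℝ) (hA0 : 0 < A0) (κ : ℝ) (hκ : 0 < κ) :
    ∃ g : ℝ → ℝ, ContDiff ℝ (⊤ : ℕ∞) g ∧ g 0 = 0 ∧
      (∀ s t : ℝ, |g t - g s| ≤ (C * 3 ^ q) * |t - s| ^ p * (1 + |t| + |s|) ^ q) ∧
      (∀ t, |t| ≤ A0 → |v t - g t| ≤ κ) := by
  have e2 : ∃ η : ℝ, 0 < η ∧ η ≤ 1 ∧ (C * (2 + 2 * A0) ^ q) * η ^ p ≤ κ / 2 := by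
    have h : Tendsto (fun x : ℝ => (C * (2 + 2 * A0) ^ q) * x ^ p) (𝓝[>] 0)
        (𝓝 ((C * (2 + 2 * A0) ^ q) * 0 ^ p)) :=
      ((Real.continuousAt_rpow_const 0 p (Or.inr hp.le)).tendsto.mono_left
        nhdsWithin_le_nhds).const_mul _
    rw [Real.zero_rpow (by linarith), mul_zero] at h
    have h2 := (h.eventually (ge_mem_nhds (half_pos hκ))).and
      (Ioo_mem_nhdsGT (show (0:ℝ) < 1 by norm_num))
    obtain ⟨a, ha, ha'⟩ := h2.exists
    exact ⟨a, ha'.1, ha'.2.le, ha⟩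
  obtain ⟨η, hη, hη1, hηκ⟩ := e2
  let b : ContDiffBump (0 : ℝ) := ⟨η / 2, η, by linarith, by linarith⟩
  have hbr : b.rOut = η := rfl
  let G : ℝ → ℝ := convolution (b.normed volume) v (ContinuousLinearMap.lsmul ℝ ℝ) volume
  have hG : ContDiff ℝ (⊤ : ℕ∞) G :=
    b.hasCompactSupport_normed.contDiff_convolution_left _ b.contDiff_normed
      hv.locallyIntegrable
  have hGv : ∀ t, |t| ≤ A0 → |G t - v t| ≤ κ / 2 := by
    intro t ht
    have := b.dist_normed_convolution_le (μ := volume) (g := v) (x₀ := t) (ε := κ / 2)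
      hv.aestronglyMeasurable ?_
    · rwa [Real.dist_eq] at this
    · intro x hx
      rw [Metric.mem_ball, Real.dist_eq, hbr] at hx
      rw [Real.dist_eq]
      refine (hb t x).trans ?_
      have hxA : 1 + |x| + |t| ≤ 2 + 2 * A0 := by
        have : |x| ≤ |x - t| + |t| := by simpa using abs_add_le (x - t) t
        linarith
      calc C * |x - t| ^ p * (1 + |x| + |t|) ^ q ≤ C * η ^ p * (2 + 2 * A0) ^ q := by gcongr
        _ ≤ κ / 2 := by linarith
  have hintg : ∀ t, Integrable (fun y => b.normed volume y * v (t - y)) := by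
    intro t
    apply Continuous.integrable_of_hasCompactSupport
    · have := b.continuous_normed (μ := volume)
      fun_prop
    · exact b.hasCompactSupport_normed.mul_right
  have hGH : ∀ s t : ℝ, |G t - G s| ≤ (C * 3 ^ q) * |t - s| ^ p * (1 + |t| + |s|) ^ q := by
    intro s t
    have hGe : ∀ t, G t = ∫ y, b.normed volume y * v (t - y) := by
      intro t
      simp [G, convolution]
    rw [hGe, hGe, ← integral_sub (hintg t) (hintg s), ← Real.norm_eq_abs]
    set B := (C * 3 ^ q) * |t - s| ^ p * (1 + |t| + |s|) ^ q with hB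
    have : ∫ y, b.normed volume y * B = B := by
      rw [integral_mul_const, b.integral_normed, one_mul]
    rw [← this]
    apply norm_integral_le_of_norm_le (b.integrable_normed.mul_const B)
    refine Eventually.of_forall fun y => ?_
    rw [← mul_sub, norm_mul, Real.norm_eq_abs, Real.norm_eq_abs, abs_of_nonneg (b.nonneg_normed y)]
    by_cases hy : b.normed volume y = 0
    · rw [hy]; simp
    have hy' : y ∈ Function.support (b.normed volume) := hy
    rw [b.support_normed_eq, hbr, Metric.mem_ball, dist_zero_right, Real.norm_eq_abs] at hy'
    apply mul_le_mul_of_nonneg_left _ (b.nonneg_normed y)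
    refine (hb _ _).trans ?_
    have k0 : t - y - (s - y) = t - s := by ring
    have k1 : 1 + |t - y| + |s - y| ≤ 3 * (1 + |t| + |s|) := by
      have := abs_sub t y
      have := abs_sub s y
      linarith [abs_nonneg t, abs_nonneg s]
    rw [k0]
    calc C * |t - s| ^ p * (1 + |t - y| + |s - y|) ^ q
        ≤ C * |t - s| ^ p * (3 * (1 + |t| + |s|)) ^ q := by gcongr
      _ = B := by rw [Real.mul_rpow (by norm_num) (by positivity), hB]; ring
  refine ⟨fun t => G t - G 0, hG.sub contDiff_const, by simp, ?_, ?_⟩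
  · intro s t
    simpa using hGH s t
  · intro t ht
    have h1 := hGv t ht
    have h2 := hGv 0 (by simpa using hA0.le)
    rw [hv0, sub_zero] at h2
    rw [abs_le] at *
    constructor <;> linarith [h1.1, h1.2, h2.1, h2.2]

lemma aux_cutoff (p q : ℝ) (hp : 0 < p) (hp1 : p ≤ 1) (hq : 0 ≤ q) :
    ∃ M : ℝ, 0 ≤ M ∧ ∀ D : ℝ, 0 ≤ D → ∀ g : ℝ → ℝ, ContDiff ℝ (⊤ : ℕ∞) g → g 0 = 0 →
      (∀ s t : ℝ, |g t - g s| ≤ D * |t - s| ^ p * (1 + |t| + |s|) ^ q) →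
      ∀ R : ℝ, 0 < R → ∃ φ : ℝ → ℝ, ContDiff ℝ (⊤ : ℕ∞) φ ∧ HasCompactSupport φ ∧
        (∀ t, |t| ≤ R → φ t = g t) ∧
        (∀ s t : ℝ, |φ t - φ s| ≤ (D * M) * |t - s| ^ p * (1 + |t| + |s|) ^ q) := by
  let b : ContDiffBump (0 : ℝ) := ⟨1, 2, by norm_num, by norm_num⟩
  have hbs : ContDiff ℝ (⊤ : ℕ∞) b := b.contDiff
  obtain ⟨L, hL⟩ := hbs.lipschitzWith_of_hasCompactSupport b.hasCompactSupport (by simp)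
  refine ⟨1 + (2 * (L : ℝ)) ^ p, by positivity, ?_⟩
  intro D hD g hg hg0 hgb R hR
  have hz : ∀ t, 2 * R ≤ |t| → b (R⁻¹ * t) = 0 := by
    intro t ht
    apply b.zero_of_le_dist
    rw [dist_zero_right, Real.norm_eq_abs, abs_mul, abs_of_pos (inv_pos.2 hR)]
    change (2:ℝ) ≤ _
    rw [inv_mul_eq_div, le_div_iff₀ hR]; exact ht
  refine ⟨fun t => b (R⁻¹ * t) * g t, ?_, ?_, ?_, ?_⟩
  · exact (hbs.comp (contDiff_const.mul contDiff_id)).mul hg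
  · apply HasCompactSupport.intro (isCompact_closedBall (0:ℝ) (2 * R))
    intro t ht
    rw [Metric.mem_closedBall, dist_zero_right, Real.norm_eq_abs, not_le] at ht
    simp [hz t ht.le]
  · intro t ht
    have : b (R⁻¹ * t) = 1 := by
      apply b.one_of_mem_closedBall
      rw [Metric.mem_closedBall, dist_zero_right, Real.norm_eq_abs, abs_mul,
        abs_of_pos (inv_pos.2 hR)]
      change _ ≤ (1:ℝ)
      rw [inv_mul_eq_div, div_le_iff₀ hR]; linarith
    simp [this]
  · have key : ∀ s t : ℝ, |s| ≤ |t| → |b (R⁻¹ * t) * g t - b (R⁻¹ * s) * g s| ≤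
        (D * (1 + (2 * (L : ℝ)) ^ p)) * |t - s| ^ p * (1 + |t| + |s|) ^ q := by
      intro s t hst
      rcases le_total (2 * R) |s| with h | h
      · rw [hz s h, hz t (h.trans hst)]
        simp only [zero_mul, sub_zero, abs_zero]
        positivity
      have d1 : |b (R⁻¹ * t)| ≤ 1 := by rw [abs_of_nonneg b.nonneg]; exact b.le_one
      have d2 : |b (R⁻¹ * t) - b (R⁻¹ * s)| ≤ (L * |t - s| / R) ^ p := by
        have l1 : |b (R⁻¹ * t) - b (R⁻¹ * s)| ≤ L * |t - s| / R := by
          have := hL.dist_le_mul (R⁻¹ * t) (R⁻¹ * s)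
          rw [Real.dist_eq, Real.dist_eq, ← mul_sub, abs_mul, abs_of_pos (inv_pos.2 hR)] at this
          refine this.trans (le_of_eq ?_)
          field_simp
        have l2 : |b (R⁻¹ * t) - b (R⁻¹ * s)| ≤ 1 := by
          rw [abs_le]
          constructor <;> linarith [b.nonneg (x := R⁻¹ * t), b.nonneg (x := R⁻¹ * s),
            b.le_one (x := R⁻¹ * t), b.le_one (x := R⁻¹ * s)]
        calc |b (R⁻¹ * t) - b (R⁻¹ * s)| ≤ |b (R⁻¹ * t) - b (R⁻¹ * s)| ^ p :=
              Real.self_le_rpow_of_le_one (abs_nonneg _) l2 hp1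
          _ ≤ _ := Real.rpow_le_rpow (abs_nonneg _) l1 hp.le
      have d3 : |g s| ≤ D * (2 * R) ^ p * (1 + |t| + |s|) ^ q := by
        have := hgb 0 s
        rw [hg0, sub_zero, sub_zero, abs_zero, add_zero] at this
        refine this.trans ?_
        gcongr
        linarith [abs_nonneg s]
      have d4 : (L * |t - s| / R) ^ p * (2 * R) ^ p = (2 * L) ^ p * |t - s| ^ p := by
        rw [← Real.mul_rpow (by positivity) (by positivity),
          ← Real.mul_rpow (by positivity) (by positivity)]
        congr 1
        field_simp
      calc |b (R⁻¹ * t) * g t - b (R⁻¹ * s) * g s|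
          = |b (R⁻¹ * t) * (g t - g s) + (b (R⁻¹ * t) - b (R⁻¹ * s)) * g s| := by
            congr 1; ring
        _ ≤ |b (R⁻¹ * t)| * |g t - g s| + |b (R⁻¹ * t) - b (R⁻¹ * s)| * |g s| := by
            rw [← abs_mul, ← abs_mul]; exact abs_add_le _ _
        _ ≤ 1 * (D * |t - s| ^ p * (1 + |t| + |s|) ^ q) +
            (L * |t - s| / R) ^ p * (D * (2 * R) ^ p * (1 + |t| + |s|) ^ q) := by
            gcongr
            exact hgb s t
        _ = D * |t - s| ^ p * (1 + |t| + |s|) ^ q +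
            ((L * |t - s| / R) ^ p * (2 * R) ^ p) * (D * (1 + |t| + |s|) ^ q) := by ring
        _ = _ := by rw [d4]; ring
    intro s t
    rcases le_total |s| |t| with h | h
    · exact key s t h
    · have := key t s h
      rw [abs_sub_comm, abs_sub_comm s t, add_right_comm] at this
      exact this

/-- For `γ, δ ∈ (0,1)`, `γ' > γ`, `δ' ≥ 0` with `γ' + δ' < γ + δ`, every continuous function
`w : ℝ₋ → ℝ` with `w 0 = 0` and finite `‖w‖_{γ',δ'}` norm belongs to `W_{(γ,δ)}`: it can be
approximated in the `‖·‖_{γ,δ}` norm by smooth compactly supported functions vanishing at `0`. -/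
theorem mem_weightedHolder_completion (γ δ γ' δ' : ℝ)
    (hγ : γ ∈ Ioo (0:ℝ) 1) (hδ : δ ∈ Ioo (0:ℝ) 1)
    (h1 : γ < γ') (h2 : 0 ≤ δ') (h3 : γ' + δ' < γ + δ)
    (w : ℝ → ℝ) (hw : Continuous w) (hw0 : w 0 = 0)
    (C : ℝ)
    (hC : ∀ s t : ℝ, s ≤ 0 → t ≤ 0 →
      |w t - w s| ≤ C * |t - s| ^ γ' * (1 + |t| + |s|) ^ δ') :
    ∀ ε > 0, ∃ φ : ℝ → ℝ, ContDiff ℝ (⊤ : ℕ∞) φ ∧ HasCompactSupport φ ∧ φ 0 = 0 ∧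
      ∀ s t : ℝ, s ≤ 0 → t ≤ 0 → s ≠ t →
        |(w t - φ t) - (w s - φ s)| ≤ ε * |t - s| ^ γ * (1 + |t| + |s|) ^ δ := by
  intro ε hε
  have hC0 : 0 ≤ C := by
    have := (abs_nonneg _).trans (hC (-1) 0 (by norm_num) le_rfl)
    have h2 : (0:ℝ) < (1 + |(0:ℝ)| + |(-1:ℝ)|) ^ δ' := by positivity
    have h3 : |(0:ℝ) - (-1)| ^ γ' = 1 := by norm_num
    rw [h3, mul_one] at this
    exact nonneg_of_mul_nonneg_left this h2
  -- reduce to Hölder exponent at most one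
  obtain ⟨p, q, hp, hp1, hq, hpq, hb⟩ : ∃ p q : ℝ, γ < p ∧ p ≤ 1 ∧ 0 ≤ q ∧ p + q < γ + δ ∧
      ∀ s t : ℝ, s ≤ 0 → t ≤ 0 → |w t - w s| ≤ C * |t - s| ^ p * (1 + |t| + |s|) ^ q := by
    rcases le_total γ' 1 with h | h
    · exact ⟨γ', δ', h1, h, h2, h3, hC⟩
    · refine ⟨1, δ' + (γ' - 1), hγ.2, le_rfl, by linarith, by linarith, ?_⟩
      intro s t hs ht
      refine (hC s t hs ht).trans ?_
      have hA : 0 < 1 + |t| + |s| := by positivity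
      rcases eq_or_ne t s with rfl | hne
      · rw [sub_self, abs_zero, Real.zero_rpow (by linarith), Real.zero_rpow (by norm_num)]
        simp
      have hd : 0 < |t - s| := abs_pos.2 (sub_ne_zero.2 hne)
      have hdA : |t - s| ≤ 1 + |t| + |s| := by linarith [abs_sub t s]
      have k1 : |t - s| ^ γ' = |t - s| ^ (1:ℝ) * |t - s| ^ (γ' - 1) := by
        rw [← Real.rpow_add hd]; ring_nf
      have k2 : |t - s| ^ (γ' - 1) ≤ (1 + |t| + |s|) ^ (γ' - 1) :=
        Real.rpow_le_rpow hd.le hdA (by linarith)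
      rw [k1, Real.rpow_add hA]
      calc C * (|t - s| ^ (1:ℝ) * |t - s| ^ (γ' - 1)) * (1 + |t| + |s|) ^ δ'
          ≤ C * (|t - s| ^ (1:ℝ) * (1 + |t| + |s|) ^ (γ' - 1)) * (1 + |t| + |s|) ^ δ' := by
            gcongr
        _ = _ := by ring
  have hp0 : 0 < p := hγ.1.trans hp
  obtain ⟨M, hM, hcut⟩ := aux_cutoff p q hp0 hp1 hq
  have hK : 0 ≤ C + C * 3 ^ q * M := by positivity
  obtain ⟨A0, hA0, κ, hκ, hintg⟩ := aux_interp γ δ p q (C + C * 3 ^ q * M) ε hγ.1 hp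
    (by linarith) hpq hδ.1 hK hε
  -- extend by zero to the right half line
  have hvb : ∀ s t : ℝ, |w (min t 0) - w (min s 0)| ≤
      C * |t - s| ^ p * (1 + |t| + |s|) ^ q := by
    intro s t
    refine (hb (min s 0) (min t 0) (min_le_right _ _) (min_le_right _ _)).trans ?_
    have m1 : |min t 0 - min s 0| ≤ |t - s| := by
      simpa using abs_min_sub_min_le_max t 0 s 0
    have m2 : ∀ x : ℝ, |min x 0| ≤ |x| := by
      intro x
      simpa using abs_min_sub_min_le_max x 0 0 0
    have m3 := m2 t
    have m4 := m2 s
    gcongr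
  obtain ⟨g, hg, hg0, hgb, hgv⟩ := aux_mollify p q C hp0 hq hC0 (fun t => w (min t 0))
    (by fun_prop) (by simpa using hw0) hvb A0 hA0 κ hκ
  obtain ⟨φ, hφ, hφc, hφg, hφb⟩ := hcut (C * 3 ^ q) (by positivity) g hg hg0 hgb A0 hA0
  refine ⟨φ, hφ, hφc, ?_, hintg (fun t => w t - φ t) ?_ ?_⟩
  · rw [hφg 0 (by simpa using hA0.le), hg0]
  · intro s t hs ht
    have a1 := hb s t hs ht
    have a2 := hφb s t
    have a3 := abs_sub (w t - w s) (φ t - φ s)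
    calc |(w t - φ t) - (w s - φ s)| = |(w t - w s) - (φ t - φ s)| := by congr 1; ring
      _ ≤ _ := a3
      _ ≤ _ := add_le_add a1 a2
      _ = _ := by ring
  · intro t ht ht0
    have := hgv t ht
    simp only [min_eq_left ht0] at this
    rwa [hφg t ht]
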